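/- Let Ω ⊂⊂ ℂⁿ be a pseudoconvex domain with smooth boundary and ρ a defining function of Ω. Let ψ be a smooth real-valued function on U and set ρ̃ := ρ·e^ψ; write Ñ := N_ρ̃ and N := N_ρ. Let L̃ and L be (1,0) tangent vector fields on U with L̃ = L on ∂Ω and L̃ρ̃ = 0, Lρ = 0 on U, and set Σ_L := {p ∈ ∂Ω : L_ρ(L,L)(p) = 0}. Then at every point of Σ_L: (i) L_ρ̃(L̃,Ñ)/‖∇ρ̃‖ = L_ρ(L,N)/‖∇ρ‖ + (1/2)(Lψ); (ii) (Ñ L_ρ̃(L̃,L̃))/‖∇ρ̃‖ = (N L_ρ(L,L))/‖∇ρ‖ + (1/2)·L_ψ(L,L) − (1/2)·|Lψ|² − 2·Re[(L_ρ(L,N)/‖∇ρ‖)·(L̄ψ)]; and in particular (iii) |L_ρ̃(L̃,Ñ)|²/‖∇ρ̃‖² + (1/2)·(Ñ L_ρ̃(L̃,L̃))/‖∇ρ̃‖ = |L_ρ(L,N)|²/‖∇ρ‖² + (1/2)·(N L_ρ(L,L))/‖∇ρ‖ + (1/4)·L_ψ(L,L). -/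

import Mathlib

noncomputable section

open Complex Topology
open scoped ENNReal

/-- Wirtinger derivative `∂f/∂z_j`. -/
def dz {n : ℕ} (j : Fin n) (f : (Fin n → ℂ) → ℂ) (z : Fin n → ℂ) : ℂ :=
  (fderiv ℝ f z (Pi.single j 1) - Complex.I * fderiv ℝ f z (Pi.single j Complex.I)) / 2

/-- Wirtinger derivative `∂f/∂z̄_j`. -/
def dzbar {n : ℕ} (j : Fin n) (f : (Fin n → ℂ) → ℂ) (z : Fin n → ℂ) : ℂ :=
  (fderiv ℝ f z (Pi.single j 1) + Complex.I * fderiv ℝ f z (Pi.single j Complex.I)) / 2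

/-- Complexification of a real-valued function. -/
def cplx {n : ℕ} (ρ : (Fin n → ℂ) → ℝ) : (Fin n → ℂ) → ℂ := fun z => (ρ z : ℂ)

/-- The Levi form `L_ρ(X,Y)(z) = Σ_{j,k} ∂²ρ/∂z_j∂z̄_k (z) X_j conj(Y_k)`. -/
def levi {n : ℕ} (ρ : (Fin n → ℂ) → ℝ) (X Y : Fin n → ℂ) (z : Fin n → ℂ) : ℂ :=
  ∑ j, ∑ k, dz j (fun w => dzbar k (cplx ρ) w) z * X j * (starRingEnd ℂ) (Y k)

/-- `Xf = Σ_j X_j ∂f/∂z_j` for a (1,0) vector `X`. -/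
def dirDeriv {n : ℕ} (X : Fin n → ℂ) (f : (Fin n → ℂ) → ℂ) (z : Fin n → ℂ) : ℂ :=
  ∑ j, X j * dz j f z

/-- `X̄f = Σ_j conj(X_j) ∂f/∂z̄_j`. -/
def dirDerivBar {n : ℕ} (X : Fin n → ℂ) (f : (Fin n → ℂ) → ℂ) (z : Fin n → ℂ) : ℂ :=
  ∑ j, (starRingEnd ℂ) (X j) * dzbar j f z

/-- Derivative of `f` along the (1,0) vector field `X`. -/
def fieldDeriv {n : ℕ} (X : (Fin n → ℂ) → (Fin n → ℂ)) (f : (Fin n → ℂ) → ℂ)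
    (z : Fin n → ℂ) : ℂ :=
  dirDeriv (X z) f z

/-- Euclidean norm of the real gradient of `ρ`. -/
def gradNorm {n : ℕ} (ρ : (Fin n → ℂ) → ℝ) (z : Fin n → ℂ) : ℝ :=
  Real.sqrt (∑ j, ((fderiv ℝ ρ z (Pi.single j 1)) ^ 2 +
    (fderiv ℝ ρ z (Pi.single j Complex.I)) ^ 2))

/-- The complex normal field `N_ρ`. -/
def nfield {n : ℕ} (ρ : (Fin n → ℂ) → ℝ) (z : Fin n → ℂ) : Fin n → ℂ := fun j =>
  ((Real.sqrt (∑ k, Complex.normSq (dz k (cplx ρ) z)) : ℝ) : ℂ)⁻¹ * dzbar j (cplx ρ) z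

/-- Squared Euclidean norm of a vector in ℂⁿ. -/
def enormSq {n : ℕ} (X : Fin n → ℂ) : ℝ := ∑ j, Complex.normSq (X j)

/-- `f` is strictly plurisubharmonic on `S`. -/
def StrictPSHOn {n : ℕ} (f : (Fin n → ℂ) → ℝ) (S : Set (Fin n → ℂ)) : Prop :=
  ∀ z ∈ S, ∀ X : Fin n → ℂ, X ≠ 0 → 0 < (levi f X X z).re

/-- `ρ` is a (global smooth) defining function of `Ω` on the neighborhood `V` of `cl Ω`. -/
structure IsDefFn {n : ℕ} (Ω V : Set (Fin n → ℂ)) (ρ : (Fin n → ℂ) → ℝ) : Prop where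
  isOpen : IsOpen V
  subset : closure Ω ⊆ V
  smooth : ContDiffOn ℝ (⊤ : ℕ∞) ρ V
  eq : Ω = {z ∈ V | ρ z < 0}
  grad_ne : ∀ z ∈ frontier Ω, fderiv ℝ ρ z ≠ 0

/-- The Levi form of `ρ` is positive semidefinite on complex tangent vectors at `z`. -/
def LeviPseudoconvexAt {n : ℕ} (ρ : (Fin n → ℂ) → ℝ) (z : Fin n → ℂ) : Prop :=
  ∀ X : Fin n → ℂ, dirDeriv X (cplx ρ) z = 0 → 0 ≤ (levi ρ X X z).re

/-- `Ω` is a (smoothly bounded, Levi) pseudoconvex domain. -/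
def IsPseudoconvex {n : ℕ} (Ω : Set (Fin n → ℂ)) : Prop :=
  ∃ (V : Set (Fin n → ℂ)) (ρ : (Fin n → ℂ) → ℝ), IsDefFn Ω V ρ ∧
    ∀ p ∈ frontier Ω, LeviPseudoconvexAt ρ p

/-- The set of Steinness exponents of `ρ`. -/
def steinExpSet {n : ℕ} (Ω : Set (Fin n → ℂ)) (ρ : (Fin n → ℂ) → ℝ) : Set ℝ :=
  {η : ℝ | 1 < η ∧ ∃ W : Set (Fin n → ℂ), IsOpen W ∧ frontier Ω ⊆ W ∧
    StrictPSHOn (fun z => ρ z ^ η) ((closure Ω)ᶜ ∩ W)}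

/-- The Steinness exponent `η̃_ρ` of a defining function `ρ` (`∞` if none exists). -/
def steinExp {n : ℕ} (Ω : Set (Fin n → ℂ)) (ρ : (Fin n → ℂ) → ℝ) : ℝ≥0∞ :=
  sInf (ENNReal.ofReal '' steinExpSet Ω ρ)

/-- The Steinness index `S(Ω)`. -/
def steinIndex {n : ℕ} (Ω : Set (Fin n → ℂ)) : ℝ≥0∞ :=
  ⨅ (V : Set (Fin n → ℂ)) (ρ : (Fin n → ℂ) → ℝ) (_ : IsDefFn Ω V ρ), steinExp Ω ρ

/-- The set of Diederich–Fornæss exponents of `ρ`. -/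
def dfExpSet {n : ℕ} (Ω : Set (Fin n → ℂ)) (ρ : (Fin n → ℂ) → ℝ) : Set ℝ :=
  {η : ℝ | 0 < η ∧ η < 1 ∧ StrictPSHOn (fun z => -((-ρ z) ^ η)) Ω}

/-- The Diederich–Fornæss exponent of `ρ` (`0` if no exponent exists). -/
def dfExp {n : ℕ} (Ω : Set (Fin n → ℂ)) (ρ : (Fin n → ℂ) → ℝ) : ℝ :=
  sSup (insert 0 (dfExpSet Ω ρ))

/-- The Diederich–Fornæss index `DF(Ω)`. -/
def dfIndex {n : ℕ} (Ω : Set (Fin n → ℂ)) : ℝ :=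
  sSup {t : ℝ | ∃ V ρ, IsDefFn Ω V ρ ∧ t = dfExp Ω ρ}

/-- `L` is a smooth (1,0) tangent vector field for `ρ` on `A`. -/
def IsTangentField {n : ℕ} (ρ : (Fin n → ℂ) → ℝ) (L : (Fin n → ℂ) → (Fin n → ℂ))
    (A : Set (Fin n → ℂ)) : Prop :=
  ContDiffOn ℝ (⊤ : ℕ∞) L A ∧ ∀ z ∈ A, dirDeriv (L z) (cplx ρ) z = 0

/-- The key differential inequality
`(1/(η₂−1))|L_ρ(L,N)|²/‖∇ρ‖² − (1/2)(N L_ρ(L,L))/‖∇ρ‖ ≤ 0` at `p`. -/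
def keyIneqAt {n : ℕ} (ρ : (Fin n → ℂ) → ℝ) (L : (Fin n → ℂ) → (Fin n → ℂ)) (η₂ : ℝ)
    (p : Fin n → ℂ) : Prop :=
  1 / (η₂ - 1) * Complex.normSq (levi ρ (L p) (nfield ρ p) p) / (gradNorm ρ p) ^ 2 -
    1 / 2 * (fieldDeriv (nfield ρ) (fun w => levi ρ (L w) (L w) w) p).re / gradNorm ρ p ≤ 0

/-- The strict version of the key differential inequality. -/
def strictKeyIneqAt {n : ℕ} (ρ : (Fin n → ℂ) → ℝ) (L : (Fin n → ℂ) → (Fin n → ℂ)) (η₂ : ℝ)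
    (p : Fin n → ℂ) : Prop :=
  1 / (η₂ - 1) * Complex.normSq (levi ρ (L p) (nfield ρ p) p) / (gradNorm ρ p) ^ 2 -
    1 / 2 * (fieldDeriv (nfield ρ) (fun w => levi ρ (L w) (L w) w) p).re / gradNorm ρ p < 0

/-- `cl Ω` has a strong Stein neighborhood basis. -/
def HasStrongSteinBasis {n : ℕ} (Ω : Set (Fin n → ℂ)) : Prop :=
  ∃ (V : Set (Fin n → ℂ)) (ρ : (Fin n → ℂ) → ℝ), IsDefFn Ω V ρ ∧ ∃ ε₀ : ℝ, 0 < ε₀ ∧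
    (∀ z ∈ V, 0 ≤ ρ z → ρ z < ε₀ → fderiv ℝ ρ z ≠ 0) ∧
    ∀ ε : ℝ, 0 ≤ ε → ε < ε₀ → ∀ z ∈ V, ρ z = ε → LeviPseudoconvexAt ρ z

/-- Vanishing order at `0` of a holomorphic function `ℂ → ℂ` (`∞` if all derivatives vanish). -/
def orderC (h : ℂ → ℂ) : ℕ∞ :=
  sInf ((fun k : ℕ => (k : ℕ∞)) '' {k : ℕ | iteratedDeriv k h 0 ≠ 0})

/-- Vanishing order at `0` of a real-valued function on `ℂ`. -/
def orderR (g : ℂ → ℝ) : ℕ∞ :=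
  sInf ((fun k : ℕ => (k : ℕ∞)) '' {k : ℕ | iteratedFDeriv ℝ k g 0 ≠ 0})

/-- `ν(γ)`: minimal vanishing order at `0` of the components of `γ − p`. -/
def curveOrder {n : ℕ} (γ : ℂ → Fin n → ℂ) (p : Fin n → ℂ) : ℕ∞ :=
  ⨅ j, orderC (fun t => γ t j - p j)

/-- `p` is a boundary point of finite D'Angelo 1-type (w.r.t. the defining function `ρ`). -/
def FiniteTypePt {n : ℕ} (ρ : (Fin n → ℂ) → ℝ) (p : Fin n → ℂ) : Prop :=
  ∃ M : ℕ, ∀ γ : ℂ → Fin n → ℂ, (∀ j, AnalyticAt ℂ (fun t => γ t j) 0) → γ 0 = p →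
    ¬ (∀ᶠ t in nhds (0 : ℂ), γ t = p) →
    orderR (fun t => ρ (γ t)) ≤ (M : ℕ∞) * curveOrder γ p

section Wirtinger

variable {n : ℕ} {f g : (Fin n → ℂ) → ℂ} {a b : (Fin n → ℂ) → ℝ} {z : Fin n → ℂ}

lemma dz_congr (j : Fin n) (h : f =ᶠ[𝓝 z] g) : dz j f z = dz j g z := by
  simp only [dz, h.fderiv_eq]

lemma dz_add (j : Fin n) (hf : DifferentiableAt ℝ f z) (hg : DifferentiableAt ℝ g z) :
    dz j (fun w => f w + g w) z = dz j f z + dz j g z := by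
  simp only [dz, fderiv_fun_add hf hg, _root_.add_apply]
  ring

lemma dz_mul (j : Fin n) (hf : DifferentiableAt ℝ f z) (hg : DifferentiableAt ℝ g z) :
    dz j (fun w => f w * g w) z = f z * dz j g z + dz j f z * g z := by
  simp only [dz, fderiv_fun_mul hf hg, _root_.add_apply,
    _root_.smul_apply, smul_eq_mul]
  ring

lemma fderiv_cplx (ha : DifferentiableAt ℝ a z) (v : Fin n → ℂ) :
    fderiv ℝ (cplx a) z v = (fderiv ℝ a z v : ℝ) := by
  have h := (Complex.ofRealCLM.hasFDerivAt (x := a z)).comp z ha.hasFDerivAt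
  rw [show cplx a = Complex.ofRealCLM ∘ a from rfl, h.fderiv]
  simp

lemma differentiableAt_cplx (ha : DifferentiableAt ℝ a z) : DifferentiableAt ℝ (cplx a) z :=
  Complex.ofRealCLM.differentiableAt.comp z ha

lemma contDiffAt_cplx (ha : ContDiffAt ℝ (⊤ : ℕ∞) a z) : ContDiffAt ℝ (⊤ : ℕ∞) (cplx a) z :=
  Complex.ofRealCLM.contDiff.contDiffAt.comp z ha

lemma dzbar_cplx (k : Fin n) (ha : DifferentiableAt ℝ a z) :
    dzbar k (cplx a) z = (starRingEnd ℂ) (dz k (cplx a) z) := by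
  simp only [dz, dzbar, fderiv_cplx ha, map_div₀, map_sub, map_mul, Complex.conj_ofReal,
    Complex.conj_I, map_ofNat]
  ring

lemma dz_cplx_mul_exp (j : Fin n) (ha : DifferentiableAt ℝ a z) (hb : DifferentiableAt ℝ b z) :
    dz j (cplx fun w => a w * Real.exp (b w)) z =
      Real.exp (b z) * (dz j (cplx a) z + a z * dz j (cplx b) z) := by
  simp only [dz, fderiv_cplx ha, fderiv_cplx hb, fderiv_cplx (ha.fun_mul hb.exp),
    fderiv_fun_mul ha hb.exp, fderiv_exp hb, _root_.add_apply,
    _root_.smul_apply, smul_eq_mul]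
  push_cast
  ring

lemma dzbar_cplx_mul_exp (j : Fin n) (ha : DifferentiableAt ℝ a z)
    (hb : DifferentiableAt ℝ b z) :
    dzbar j (cplx fun w => a w * Real.exp (b w)) z =
      cplx (fun w => Real.exp (b w)) z *
        (dzbar j (cplx a) z + cplx a z * dzbar j (cplx b) z) := by
  rw [dzbar_cplx j (ha.fun_mul hb.exp), dz_cplx_mul_exp j ha hb, dzbar_cplx j ha, dzbar_cplx j hb]
  simp [cplx, ← Complex.exp_conj]

lemma contDiffAt_dz (j : Fin n) (hf : ContDiffAt ℝ (⊤ : ℕ∞) f z) :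
    ContDiffAt ℝ (⊤ : ℕ∞) (dz j f) z := by
  have h : ContDiffAt ℝ (⊤ : ℕ∞) (fderiv ℝ f) z := hf.fderiv_right (by simp)
  unfold dz
  fun_prop

lemma contDiffAt_dzbar (j : Fin n) (hf : ContDiffAt ℝ (⊤ : ℕ∞) f z) :
    ContDiffAt ℝ (⊤ : ℕ∞) (dzbar j f) z := by
  have h : ContDiffAt ℝ (⊤ : ℕ∞) (fderiv ℝ f) z := hf.fderiv_right (by simp)
  unfold dzbar
  fun_prop

lemma differentiableAt_of_top {F : Type*} [NormedAddCommGroup F] [NormedSpace ℝ F]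
    {u : (Fin n → ℂ) → F} (hu : ContDiffAt ℝ (⊤ : ℕ∞) u z) : DifferentiableAt ℝ u z :=
  hu.differentiableAt (by simp)

lemma dz_dzbar_cplx_conj (j k : Fin n) (ha : ContDiffAt ℝ (⊤ : ℕ∞) a z) :
    dz j (fun w => dzbar k (cplx a) w) z =
      (starRingEnd ℂ) (dz k (fun w => dzbar j (cplx a) w) z) := by
  have hd : DifferentiableAt ℝ (fderiv ℝ a) z :=
    differentiableAt_of_top (ha.fderiv_right (m := (⊤ : ℕ∞)) (by simp))
  have hsymm : IsSymmSndFDerivAt ℝ a z := ha.isSymmSndFDerivAt (by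
    rw [minSmoothness_of_isRCLikeNormedField]
    exact WithTop.coe_le_coe.2 (le_top (a := (2 : ℕ∞))))
  have key : ∀ l : Fin n, ∀ v : Fin n → ℂ,
      fderiv ℝ (fun w => dzbar l (cplx a) w) z v =
        ((fderiv ℝ (fderiv ℝ a) z v (Pi.single l 1) : ℝ) +
          Complex.I * (fderiv ℝ (fderiv ℝ a) z v (Pi.single l Complex.I) : ℝ)) / 2 := by
    intro l v
    have hev : (fun w => dzbar l (cplx a) w) =ᶠ[𝓝 z] fun w =>
        ((fderiv ℝ a w (Pi.single l 1) : ℝ) +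
          Complex.I * (fderiv ℝ a w (Pi.single l Complex.I) : ℝ)) / 2 := by
      have : ∀ᶠ w in 𝓝 z, ContDiffAt ℝ 1 a w :=
        (ha.of_le (by simp) : ContDiffAt ℝ 1 a z).eventually (by simp)
      filter_upwards [this] with w hw
      have hw' := hw.differentiableAt (by simp)
      simp only [dzbar, fderiv_cplx hw']
    rw [hev.fderiv_eq]
    have h1 : ∀ u : Fin n → ℂ, HasFDerivAt (fun w => ((fderiv ℝ a w u : ℝ) : ℂ))
        (Complex.ofRealCLM.comp ((fderiv ℝ (fderiv ℝ a) z).flip u)) z := by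
      intro u
      have h2 := hd.hasFDerivAt.clm_apply (hasFDerivAt_const u z)
      have h3 := (Complex.ofRealCLM.hasFDerivAt (x := fderiv ℝ a z u)).comp z h2
      rw [ContinuousLinearMap.comp_zero, zero_add] at h3
      exact h3
    have h4 := ((h1 (Pi.single l 1)).add ((h1 (Pi.single l Complex.I)).const_mul
      Complex.I)).mul_const (2⁻¹ : ℂ)
    have h5 := h4.fderiv
    simp only [div_eq_mul_inv]
    erw [h5]
    simp
    ring
  simp only [dz, key, map_div₀, map_sub, map_mul, map_add, Complex.conj_ofReal,
    Complex.conj_I, map_ofNat]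
  rw [hsymm (Pi.single j 1) (Pi.single k 1), hsymm (Pi.single j Complex.I) (Pi.single k 1),
    hsymm (Pi.single j 1) (Pi.single k Complex.I),
    hsymm (Pi.single j Complex.I) (Pi.single k Complex.I)]
  ring

lemma dirDeriv_congr (X : Fin n → ℂ) (h : f =ᶠ[𝓝 z] g) : dirDeriv X f z = dirDeriv X g z := by
  simp only [dirDeriv, dz_congr _ h]

lemma dirDeriv_add (X : Fin n → ℂ) (hf : DifferentiableAt ℝ f z) (hg : DifferentiableAt ℝ g z) :
    dirDeriv X (fun w => f w + g w) z = dirDeriv X f z + dirDeriv X g z := by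
  simp only [dirDeriv, dz_add _ hf hg, mul_add, Finset.sum_add_distrib]

lemma dirDeriv_mul (X : Fin n → ℂ) (hf : DifferentiableAt ℝ f z) (hg : DifferentiableAt ℝ g z) :
    dirDeriv X (fun w => f w * g w) z = f z * dirDeriv X g z + dirDeriv X f z * g z := by
  simp only [dirDeriv, dz_mul _ hf hg, Finset.mul_sum, Finset.sum_mul, ← Finset.sum_add_distrib]
  exact Finset.sum_congr rfl fun _ _ => by ring

lemma dirDeriv_sum {ι : Type*} (s : Finset ι) {F : ι → (Fin n → ℂ) → ℂ} (X : Fin n → ℂ)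
    (hF : ∀ i ∈ s, DifferentiableAt ℝ (F i) z) :
    dirDeriv X (fun w => ∑ i ∈ s, F i w) z = ∑ i ∈ s, dirDeriv X (F i) z := by
  simp only [dirDeriv, dz, fderiv_fun_sum hF, _root_.sum_apply]
  rw [Finset.sum_comm]
  refine Finset.sum_congr rfl fun j _ => ?_
  rw [Finset.mul_sum, ← Finset.sum_sub_distrib, Finset.sum_div, Finset.mul_sum]

lemma dirDeriv_sub_left (X Y : Fin n → ℂ) :
    dirDeriv (X - Y) f z = dirDeriv X f z - dirDeriv Y f z := by
  simp only [dirDeriv, Pi.sub_apply, sub_mul, Finset.sum_sub_distrib]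

lemma dirDeriv_smul_left (c : ℂ) (X : Fin n → ℂ) :
    dirDeriv (c • X) f z = c * dirDeriv X f z := by
  simp only [dirDeriv, Pi.smul_apply, smul_eq_mul, Finset.mul_sum, mul_assoc]

lemma dirDerivBar_cplx (X : Fin n → ℂ) (ha : DifferentiableAt ℝ a z) :
    dirDerivBar X (cplx a) z = (starRingEnd ℂ) (dirDeriv X (cplx a) z) := by
  simp only [dirDeriv, dirDerivBar, map_sum, map_mul, dzbar_cplx _ ha]

end Wirtinger

section Levi

variable {n : ℕ} {a b : (Fin n → ℂ) → ℝ} {z : Fin n → ℂ}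

lemma levi_add_left (X X' Y : Fin n → ℂ) : levi a (X + X') Y z = levi a X Y z + levi a X' Y z := by
  simp only [levi, Pi.add_apply, mul_add, add_mul, Finset.sum_add_distrib]

lemma levi_smul_left (c : ℂ) (X Y : Fin n → ℂ) : levi a (c • X) Y z = c * levi a X Y z := by
  simp only [levi, Pi.smul_apply, smul_eq_mul, Finset.mul_sum]
  exact Finset.sum_congr rfl fun _ _ => Finset.sum_congr rfl fun _ _ => by ring

lemma levi_conj (ha : ContDiffAt ℝ (⊤ : ℕ∞) a z) (X Y : Fin n → ℂ) :
    (starRingEnd ℂ) (levi a X Y z) = levi a Y X z := by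
  simp only [levi, map_sum, map_mul, Complex.conj_conj]
  rw [Finset.sum_comm]
  refine Finset.sum_congr rfl fun j _ => Finset.sum_congr rfl fun k _ => ?_
  rw [dz_dzbar_cplx_conj j k ha]
  ring

lemma levi_add_right (X Y Y' : Fin n → ℂ) :
    levi a X (Y + Y') z = levi a X Y z + levi a X Y' z := by
  simp only [levi, Pi.add_apply, map_add, mul_add, Finset.sum_add_distrib]

lemma levi_smul_right (c : ℂ) (X Y : Fin n → ℂ) :
    levi a X (c • Y) z = (starRingEnd ℂ) c * levi a X Y z := by
  simp only [levi, Pi.smul_apply, smul_eq_mul, map_mul, Finset.mul_sum]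
  exact Finset.sum_congr rfl fun _ _ => Finset.sum_congr rfl fun _ _ => by ring

/-- A null vector of the semidefinite Levi form is orthogonal to every complex tangent vector. -/
lemma levi_eq_zero_of_null (ha : ContDiffAt ℝ (⊤ : ℕ∞) a z) (hpsc : LeviPseudoconvexAt a z)
    {X T : Fin n → ℂ} (hX : dirDeriv X (cplx a) z = 0) (hT : dirDeriv T (cplx a) z = 0)
    (hnull : levi a X X z = 0) : levi a X T z = 0 := by
  set c := levi a X T z with hc
  have hTX : levi a T X z = (starRingEnd ℂ) c := by rw [hc, levi_conj ha]
  set B := (levi a T T z).re with hB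
  have hquad : ∀ t : ℝ, 0 ≤ 2 * t * Complex.normSq c + t ^ 2 * Complex.normSq c * B := by
    intro t
    have htan : dirDeriv (X + ((t : ℂ) * c) • T) (cplx a) z = 0 := by
      have : X + ((t : ℂ) * c) • T = X - (-((t : ℂ) * c)) • T := by simp
      rw [this, dirDeriv_sub_left, dirDeriv_smul_left, hX, hT]
      simp
    have h := hpsc _ htan
    rw [levi_add_left, levi_add_right, levi_add_right, levi_smul_left, levi_smul_left,
      levi_smul_right, levi_smul_right, hnull, hTX, ← hc] at h
    simp only [Complex.add_re, Complex.mul_re, Complex.mul_im, Complex.conj_re, Complex.conj_im,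
      map_mul, Complex.conj_ofReal, Complex.ofReal_re, Complex.ofReal_im, Complex.zero_re] at h
    rw [Complex.normSq_apply]
    rw [← hB] at h
    nlinarith [h]
  by_contra hne
  have hpos : 0 < Complex.normSq c := Complex.normSq_pos.mpr hne
  have h := hquad (-(1 / (1 + |B|)))
  have hB1 : 0 < 1 + |B| := by positivity
  have hle : B ≤ |B| := le_abs_self B
  have : 2 * (-(1 / (1 + |B|))) * Complex.normSq c +
      (-(1 / (1 + |B|))) ^ 2 * Complex.normSq c * B =
      Complex.normSq c / (1 + |B|) ^ 2 * (B - 2 * (1 + |B|)) := by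
    field_simp
    ring
  rw [this] at h
  have h2 : Complex.normSq c / (1 + |B|) ^ 2 * (B - 2 * (1 + |B|)) < 0 :=
    mul_neg_of_pos_of_neg (by positivity) (by linarith [abs_nonneg B])
  linarith

lemma dz_dzbar_cplx_mul_exp (j k : Fin n) (ha : ContDiffAt ℝ (⊤ : ℕ∞) a z)
    (hb : ContDiffAt ℝ (⊤ : ℕ∞) b z) :
    dz j (fun w => dzbar k (cplx fun w => a w * Real.exp (b w)) w) z =
      Real.exp (b z) * (dz j (fun w => dzbar k (cplx a) w) z +
        dz j (cplx b) z * dzbar k (cplx a) z + dz j (cplx a) z * dzbar k (cplx b) z +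
        a z * (dz j (fun w => dzbar k (cplx b) w) z +
          dz j (cplx b) z * dzbar k (cplx b) z)) := by
  have hev : (fun w => dzbar k (cplx fun w => a w * Real.exp (b w)) w) =ᶠ[𝓝 z] fun w =>
      cplx (fun w => Real.exp (b w)) w *
        (dzbar k (cplx a) w + cplx a w * dzbar k (cplx b) w) := by
    have h1 : ∀ᶠ w in 𝓝 z, ContDiffAt ℝ 1 a w :=
      (ha.of_le (by simp) : ContDiffAt ℝ 1 a z).eventually (by simp)
    have h2 : ∀ᶠ w in 𝓝 z, ContDiffAt ℝ 1 b w :=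
      (hb.of_le (by simp) : ContDiffAt ℝ 1 b z).eventually (by simp)
    filter_upwards [h1, h2] with w hw1 hw2
    exact dzbar_cplx_mul_exp k (hw1.differentiableAt (by simp)) (hw2.differentiableAt (by simp))
  have da := differentiableAt_of_top ha
  have db := differentiableAt_of_top hb
  have dca := differentiableAt_cplx da
  have dce := differentiableAt_cplx db.exp
  have dka : DifferentiableAt ℝ (fun w => dzbar k (cplx a) w) z :=
    differentiableAt_of_top (contDiffAt_dzbar k (contDiffAt_cplx ha))
  have dkb : DifferentiableAt ℝ (fun w => dzbar k (cplx b) w) z :=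
    differentiableAt_of_top (contDiffAt_dzbar k (contDiffAt_cplx hb))
  have he : dz j (cplx fun w => Real.exp (b w)) z = Real.exp (b z) * dz j (cplx b) z := by
    simp only [dz, fderiv_cplx db, fderiv_cplx db.exp, fderiv_exp db,
      _root_.smul_apply, smul_eq_mul]
    push_cast
    ring
  rw [dz_congr j hev, dz_mul j dce (dka.fun_add (dca.fun_mul dkb)), dz_add j dka (dca.fun_mul dkb),
    dz_mul j dca dkb, he]
  simp only [cplx]
  ring

lemma levi_mul_exp (ha : ContDiffAt ℝ (⊤ : ℕ∞) a z) (hb : ContDiffAt ℝ (⊤ : ℕ∞) b z)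
    (X Y : Fin n → ℂ) :
    levi (fun w => a w * Real.exp (b w)) X Y z =
      Real.exp (b z) * (levi a X Y z +
        dirDeriv X (cplx b) z * (starRingEnd ℂ) (dirDeriv Y (cplx a) z) +
        dirDeriv X (cplx a) z * (starRingEnd ℂ) (dirDeriv Y (cplx b) z) +
        a z * (levi b X Y z +
          dirDeriv X (cplx b) z * (starRingEnd ℂ) (dirDeriv Y (cplx b) z))) := by
  rw [← dirDerivBar_cplx Y (differentiableAt_of_top ha),
    ← dirDerivBar_cplx Y (differentiableAt_of_top hb)]
  simp only [levi, dirDeriv, dirDerivBar, Finset.sum_mul_sum, dz_dzbar_cplx_mul_exp _ _ ha hb]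
  simp only [Finset.mul_sum, ← Finset.sum_add_distrib]
  exact Finset.sum_congr rfl fun _ _ => Finset.sum_congr rfl fun _ _ => by ring

end Levi

section Fields

variable {n : ℕ} {a : (Fin n → ℂ) → ℝ} {Y Z : (Fin n → ℂ) → (Fin n → ℂ)} {z : Fin n → ℂ}

lemma contDiffAt_conj {f : (Fin n → ℂ) → ℂ} (hf : ContDiffAt ℝ (⊤ : ℕ∞) f z) :
    ContDiffAt ℝ (⊤ : ℕ∞) (fun w => (starRingEnd ℂ) (f w)) z :=
  Complex.conjCLE.contDiff.contDiffAt.comp z hf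

lemma contDiffAt_levi (ha : ContDiffAt ℝ (⊤ : ℕ∞) a z) (hY : ContDiffAt ℝ (⊤ : ℕ∞) Y z)
    (hZ : ContDiffAt ℝ (⊤ : ℕ∞) Z z) :
    ContDiffAt ℝ (⊤ : ℕ∞) (fun w => levi a (Y w) (Z w) w) z :=
  ContDiffAt.sum fun j _ => ContDiffAt.sum fun k _ =>
    ((contDiffAt_dz j (contDiffAt_dzbar k (contDiffAt_cplx ha))).mul (contDiffAt_pi.1 hY j)).mul
      (contDiffAt_conj (contDiffAt_pi.1 hZ k))

lemma contDiffAt_dirDeriv {f : (Fin n → ℂ) → ℂ} (hf : ContDiffAt ℝ (⊤ : ℕ∞) f z)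
    (hY : ContDiffAt ℝ (⊤ : ℕ∞) Y z) :
    ContDiffAt ℝ (⊤ : ℕ∞) (fun w => dirDeriv (Y w) f w) z :=
  ContDiffAt.sum fun j _ => (contDiffAt_pi.1 hY j).mul (contDiffAt_dz j hf)

lemma dirDeriv_levi (X : Fin n → ℂ) (ha : ContDiffAt ℝ (⊤ : ℕ∞) a z)
    (hY : ContDiffAt ℝ (⊤ : ℕ∞) Y z) (hZ : ContDiffAt ℝ (⊤ : ℕ∞) Z z) :
    dirDeriv X (fun w => levi a (Y w) (Z w) w) z =
      ∑ j, ∑ k, (dz j (fun w => dzbar k (cplx a) w) z * Y z j *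
          dirDeriv X (fun w => (starRingEnd ℂ) (Z w k)) z +
        (dz j (fun w => dzbar k (cplx a) w) z * dirDeriv X (fun w => Y w j) z +
          dirDeriv X (dz j (fun w => dzbar k (cplx a) w)) z * Y z j) *
          (starRingEnd ℂ) (Z z k)) := by
  have hR : ∀ j k, DifferentiableAt ℝ (dz j (fun w => dzbar k (cplx a) w)) z := fun j k =>
    differentiableAt_of_top (contDiffAt_dz j (contDiffAt_dzbar k (contDiffAt_cplx ha)))
  have hYj : ∀ j, DifferentiableAt ℝ (fun w => Y w j) z := fun j =>
    differentiableAt_of_top (contDiffAt_pi.1 hY j)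
  have hZk : ∀ k, DifferentiableAt ℝ (fun w => (starRingEnd ℂ) (Z w k)) z := fun k =>
    differentiableAt_of_top (contDiffAt_conj (contDiffAt_pi.1 hZ k))
  have hterm := fun j k => ((hR j k).fun_mul (hYj j)).fun_mul (hZk k)
  simp only [levi]
  rw [dirDeriv_sum _ _ fun j _ => DifferentiableAt.fun_sum fun k _ => hterm j k]
  refine Finset.sum_congr rfl fun j _ => ?_
  rw [dirDeriv_sum _ _ fun k _ => hterm j k]
  refine Finset.sum_congr rfl fun k _ => ?_
  rw [dirDeriv_mul X ((hR j k).fun_mul (hYj j)) (hZk k), dirDeriv_mul X (hR j k) (hYj j)]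

/-- Effect on the derivative of `levi a Y Y` of changing the first-order jet of `Y` by `s • v`. -/
lemma dirDeriv_levi_change (X v : Fin n → ℂ) (s : ℂ) (ha : ContDiffAt ℝ (⊤ : ℕ∞) a z)
    (hY : ContDiffAt ℝ (⊤ : ℕ∞) Y z) (hZ : ContDiffAt ℝ (⊤ : ℕ∞) Z z) (hYZ : Y z = Z z)
    (h : ∀ j, dirDeriv X (fun w => Y w j) z = dirDeriv X (fun w => Z w j) z + v j * s)
    (h' : ∀ j, dirDeriv X (fun w => (starRingEnd ℂ) (Y w j)) z =
      dirDeriv X (fun w => (starRingEnd ℂ) (Z w j)) z + (starRingEnd ℂ) (v j) * s) :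
    dirDeriv X (fun w => levi a (Y w) (Y w) w) z =
      dirDeriv X (fun w => levi a (Z w) (Z w) w) z +
        s * (levi a v (Z z) z + levi a (Z z) v z) := by
  rw [dirDeriv_levi X ha hY hY, dirDeriv_levi X ha hZ hZ]
  simp only [levi, h, h', hYZ, Finset.mul_sum, ← Finset.sum_add_distrib]
  exact Finset.sum_congr rfl fun _ _ => Finset.sum_congr rfl fun _ _ => by ring

end Fields

section Normal

variable {n : ℕ} {a b : (Fin n → ℂ) → ℝ} {z : Fin n → ℂ}

lemma normSq_dz_cplx (j : Fin n) (ha : DifferentiableAt ℝ a z) :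
    Complex.normSq (dz j (cplx a) z) = ((fderiv ℝ a z (Pi.single j 1)) ^ 2 +
      (fderiv ℝ a z (Pi.single j Complex.I)) ^ 2) / 4 := by
  simp only [dz, fderiv_cplx ha, Complex.normSq_div, Complex.normSq_ofNat]
  rw [Complex.normSq_apply]
  simp
  ring

lemma sqrt_sum_normSq_dz (ha : DifferentiableAt ℝ a z) :
    Real.sqrt (∑ k, Complex.normSq (dz k (cplx a) z)) = gradNorm a z / 2 := by
  simp only [normSq_dz_cplx _ ha, gradNorm, ← Finset.sum_div]
  rw [Real.sqrt_div' _ (by norm_num), show (4 : ℝ) = 2 ^ 2 by norm_num,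
    Real.sqrt_sq (by norm_num)]

lemma gradNorm_ne_zero (h : fderiv ℝ a z ≠ 0) : gradNorm a z ≠ 0 := by
  intro h0
  refine h (ContinuousLinearMap.ext fun x => ?_)
  have hs := (Real.sqrt_eq_zero (by positivity)).1 h0
  rw [Finset.sum_eq_zero_iff_of_nonneg fun _ _ => by positivity] at hs
  have hx : x = ∑ j, ((x j).re • (Pi.single j 1 : Fin n → ℂ) +
      (x j).im • (Pi.single j Complex.I : Fin n → ℂ)) := by
    ext i
    simp [Finset.sum_apply, Pi.single_apply, Finset.sum_add_distrib, Complex.re_add_im]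
  rw [hx, map_sum]
  refine Finset.sum_eq_zero fun j hj => ?_
  have hj := hs j hj
  have h1 : fderiv ℝ a z (Pi.single j 1) = 0 := by
    nlinarith [sq_nonneg (fderiv ℝ a z (Pi.single j 1)),
      sq_nonneg (fderiv ℝ a z (Pi.single j Complex.I))]
  have h2 : fderiv ℝ a z (Pi.single j Complex.I) = 0 := by
    nlinarith [sq_nonneg (fderiv ℝ a z (Pi.single j 1)),
      sq_nonneg (fderiv ℝ a z (Pi.single j Complex.I))]
  rw [map_add, map_smul, map_smul, h1, h2]
  simp

lemma dirDeriv_nfield (ha : DifferentiableAt ℝ a z) :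
    dirDeriv (nfield a z) (cplx a) z = (gradNorm a z : ℂ) / 2 := by
  have hsum : (∑ j, dzbar j (cplx a) z * dz j (cplx a) z) = ((gradNorm a z : ℂ) / 2) ^ 2 := by
    have h := sqrt_sum_normSq_dz ha
    have h2 := congrArg (· ^ 2) h
    simp only [Real.sq_sqrt (Finset.sum_nonneg fun k _ => Complex.normSq_nonneg
      (dz k (cplx a) z))] at h2
    have h3 := congrArg (fun t : ℝ => (t : ℂ)) h2
    push_cast at h3
    rw [← h3]
    refine Finset.sum_congr rfl fun j _ => ?_
    rw [dzbar_cplx j ha, mul_comm, Complex.mul_conj]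
  simp only [dirDeriv, nfield, mul_assoc, ← Finset.mul_sum, hsum, sqrt_sum_normSq_dz ha]
  push_cast
  rcases eq_or_ne (gradNorm a z : ℂ) 0 with h0 | h0
  · simp [h0]
  · field_simp

lemma gradNorm_mul_exp (ha : DifferentiableAt ℝ a z) (hb : DifferentiableAt ℝ b z)
    (h0 : a z = 0) :
    gradNorm (fun w => a w * Real.exp (b w)) z = Real.exp (b z) * gradNorm a z := by
  have h := sqrt_sum_normSq_dz (ha.fun_mul hb.exp)
  simp only [dz_cplx_mul_exp _ ha hb, h0, Complex.ofReal_zero, zero_mul, add_zero,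
    Complex.normSq_mul, Complex.normSq_ofReal, ← Finset.mul_sum] at h
  rw [Real.sqrt_mul (by positivity), Real.sqrt_mul_self (by positivity),
    sqrt_sum_normSq_dz ha] at h
  linarith

lemma nfield_mul_exp (ha : DifferentiableAt ℝ a z) (hb : DifferentiableAt ℝ b z)
    (h0 : a z = 0) :
    nfield (fun w => a w * Real.exp (b w)) z = nfield a z := by
  ext j
  have he : (Real.exp (b z) : ℂ) ≠ 0 := Complex.ofReal_ne_zero.2 (Real.exp_pos _).ne'
  simp only [nfield, sqrt_sum_normSq_dz ha, sqrt_sum_normSq_dz (ha.fun_mul hb.exp),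
    gradNorm_mul_exp ha hb h0, dzbar_cplx_mul_exp j ha hb]
  simp only [cplx, h0, Complex.ofReal_zero, zero_mul, add_zero, Complex.ofReal_div,
    Complex.ofReal_mul, mul_div_assoc, mul_inv]
  field_simp

end Normal

section Boundary

lemma exists_fderiv_eq_mul {E : Type*} [NormedAddCommGroup E] [NormedSpace ℝ E]
    [CompleteSpace E] {ρ φ : E → ℝ} {p : E} {ρ' φ' : E →L[ℝ] ℝ} (hρ : HasStrictFDerivAt ρ ρ' p)
    (hφ : HasStrictFDerivAt φ φ' p) (hne : ρ' ≠ 0)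
    (h : ∀ᶠ q in 𝓝 p, ρ q = ρ p → φ q = φ p) : ∃ c : ℝ, ∀ x, φ' x = c * ρ' x := by
  have hext : IsLocalExtrOn φ {x | ρ x = ρ p} p := by
    left
    filter_upwards [nhdsWithin_le_nhds h, self_mem_nhdsWithin] with q hq hq'
    exact (hq hq').ge
  obtain ⟨s, t, hst, h0⟩ := hext.exists_multipliers_of_hasStrictFDerivAt_1d hρ hφ
  have h0' : ∀ x, s * ρ' x + t * φ' x = 0 := fun x => by
    simpa using congrArg (fun l : E →L[ℝ] ℝ => l x) h0
  have ht : t ≠ 0 := by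
    rintro rfl
    have hs : s ≠ 0 := fun hs => hst (by simp [hs])
    exact hne (ContinuousLinearMap.ext fun x => by simpa [hs] using h0' x)
  refine ⟨-s / t, fun x => ?_⟩
  field_simp
  linarith [h0' x]

lemma exists_fderiv_eq_mul_complex {E : Type*} [NormedAddCommGroup E] [NormedSpace ℝ E]
    [CompleteSpace E] {ρ : E → ℝ} {φ : E → ℂ} {p : E} (hρ : ContDiffAt ℝ (⊤ : ℕ∞) ρ p)
    (hφ : ContDiffAt ℝ (⊤ : ℕ∞) φ p) (hne : fderiv ℝ ρ p ≠ 0)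
    (h : ∀ᶠ q in 𝓝 p, ρ q = ρ p → φ q = φ p) :
    ∃ c : ℂ, ∀ x, fderiv ℝ φ p x = c * (fderiv ℝ ρ p x : ℝ) := by
  have sρ := hρ.hasStrictFDerivAt (by simp)
  have sφ := hφ.hasStrictFDerivAt (by simp)
  obtain ⟨c, hc⟩ := exists_fderiv_eq_mul sρ
    (Complex.reCLM.hasStrictFDerivAt.comp p sφ) hne
    (h.mono fun q hq hq' => by simp [hq hq'])
  obtain ⟨d, hd⟩ := exists_fderiv_eq_mul sρ
    (Complex.imCLM.hasStrictFDerivAt.comp p sφ) hne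
    (h.mono fun q hq hq' => by simp [hq hq'])
  refine ⟨⟨c, d⟩, fun x => Complex.ext ?_ ?_⟩
  · simpa using hc x
  · simpa using hd x

variable {n : ℕ} {Ω V : Set (Fin n → ℂ)} {ρ : (Fin n → ℂ) → ℝ} {p : Fin n → ℂ}

lemma IsDefFn.mem_of_frontier (h : IsDefFn Ω V ρ) (hp : p ∈ frontier Ω) : p ∈ V :=
  h.subset (frontier_subset_closure hp)

lemma IsDefFn.contDiffAt (h : IsDefFn Ω V ρ) (hp : p ∈ V) : ContDiffAt ℝ (⊤ : ℕ∞) ρ p :=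
  h.smooth.contDiffAt (h.isOpen.mem_nhds hp)

lemma IsDefFn.eq_zero_of_frontier (h : IsDefFn Ω V ρ) (hΩ : IsOpen Ω) (hp : p ∈ frontier Ω) :
    ρ p = 0 := by
  have hV := h.mem_of_frontier hp
  have hnot : p ∉ Ω := by
    rw [hΩ.frontier_eq] at hp
    exact hp.2
  have hge : 0 ≤ ρ p := by
    by_contra hlt
    exact hnot (by rw [h.eq]; exact ⟨hV, not_le.1 hlt⟩)
  have hle : ρ p ≤ 0 := by
    by_contra hgt
    have hev := (h.contDiffAt hV).continuousAt.eventually (lt_mem_nhds (not_le.1 hgt))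
    obtain ⟨q, hq, hq'⟩ :=
      (mem_closure_iff_frequently.1 (frontier_subset_closure hp)).and_eventually hev |>.exists
    rw [h.eq] at hq
    exact lt_asymm hq.2 hq'
  exact le_antisymm hle hge

/-- Near a boundary point the zero set of a defining function is contained in the boundary. -/
lemma IsDefFn.eventually_mem_frontier (h : IsDefFn Ω V ρ) (hp : p ∈ frontier Ω) :
    ∀ᶠ q in 𝓝 p, ρ q = 0 → q ∈ frontier Ω := by
  have hV := h.mem_of_frontier hp
  have hcont : ContinuousAt (fderiv ℝ ρ) p :=
    ((h.contDiffAt hV).fderiv_right (m := (⊤ : ℕ∞)) (by simp)).continuousAt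
  filter_upwards [h.isOpen.mem_nhds hV, hcont.eventually_ne (h.grad_ne p hp)] with q hqV hq h0
  refine ⟨?_, fun hqi => ?_⟩
  · by_contra hcl
    refine hq (IsLocalMin.fderiv_eq_zero ?_)
    filter_upwards [isClosed_closure.isOpen_compl.mem_nhds hcl, h.isOpen.mem_nhds hqV]
      with w hw hwV
    rw [h0]
    by_contra hlt
    exact hw (subset_closure (by rw [h.eq]; exact ⟨hwV, not_le.1 hlt⟩))
  · have := interior_subset hqi
    rw [h.eq] at this
    exact absurd h0 this.2.ne

end Boundary

section Jet

variable {n : ℕ} {a b : (Fin n → ℂ) → ℝ} {z : Fin n → ℂ} {f : (Fin n → ℂ) → ℂ} {c : ℂ}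

lemma dz_of_fderiv_eq_mul (j : Fin n) (ha : DifferentiableAt ℝ a z)
    (h : ∀ x, fderiv ℝ f z x = c * (fderiv ℝ a z x : ℝ)) :
    dz j f z = c * dz j (cplx a) z := by
  simp only [dz, h, fderiv_cplx ha]
  ring

lemma dirDeriv_of_fderiv_eq_mul (X : Fin n → ℂ) (ha : DifferentiableAt ℝ a z)
    (h : ∀ x, fderiv ℝ f z x = c * (fderiv ℝ a z x : ℝ)) :
    dirDeriv X f z = c * dirDeriv X (cplx a) z := by
  simp only [dirDeriv, dz_of_fderiv_eq_mul _ ha h, Finset.mul_sum]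
  exact Finset.sum_congr rfl fun _ _ => by ring

lemma fderiv_conj_of_eq_mul (hf : DifferentiableAt ℝ f z)
    (h : ∀ x, fderiv ℝ f z x = c * (fderiv ℝ a z x : ℝ)) (x : Fin n → ℂ) :
    fderiv ℝ (fun w => (starRingEnd ℂ) (f w)) z x =
      (starRingEnd ℂ) c * (fderiv ℝ a z x : ℝ) := by
  have h1 := (Complex.conjCLE.toContinuousLinearMap.hasFDerivAt (x := f z)).comp z hf.hasFDerivAt
  have h2 : fderiv ℝ (fun w => (starRingEnd ℂ) (f w)) z = _ := h1.fderiv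
  rw [h2]
  simp [h]

lemma dirDeriv_mul_exp (X : Fin n → ℂ) (ha : DifferentiableAt ℝ a z)
    (hb : DifferentiableAt ℝ b z) :
    dirDeriv X (cplx fun w => a w * Real.exp (b w)) z =
      Real.exp (b z) * (dirDeriv X (cplx a) z + a z * dirDeriv X (cplx b) z) := by
  simp only [dirDeriv, dz_cplx_mul_exp _ ha hb, Finset.mul_sum, ← Finset.sum_add_distrib]
  exact Finset.sum_congr rfl fun _ _ => by ring

/-- A field tangent to the level sets of `a * exp b` is tangent to those of `a` up to an
explicit error vanishing on the zero set of `a`. -/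
lemma dirDeriv_eq_of_tangent_mul_exp {X : Fin n → ℂ} (ha : DifferentiableAt ℝ a z)
    (hb : DifferentiableAt ℝ b z) (h : dirDeriv X (cplx fun w => a w * Real.exp (b w)) z = 0) :
    dirDeriv X (cplx a) z = -(a z * dirDeriv X (cplx b) z) := by
  rw [dirDeriv_mul_exp X ha hb] at h
  have he : (Real.exp (b z) : ℂ) ≠ 0 := Complex.ofReal_ne_zero.2 (Real.exp_pos _).ne'
  exact eq_neg_of_add_eq_zero_left ((mul_eq_zero.1 h).resolve_left he)

/-- At a zero of `a` and of `levi a Y Y`, the derivative of `levi (a * exp b) Y Y` for a field `Y`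
tangent to the level sets of `a * exp b`. -/
lemma dirDeriv_levi_mul_exp {Y : (Fin n → ℂ) → (Fin n → ℂ)} (X : Fin n → ℂ)
    (ha : ∀ᶠ w in 𝓝 z, ContDiffAt ℝ (⊤ : ℕ∞) a w)
    (hb : ∀ᶠ w in 𝓝 z, ContDiffAt ℝ (⊤ : ℕ∞) b w)
    (hY : ContDiffAt ℝ (⊤ : ℕ∞) Y z)
    (htan : ∀ᶠ w in 𝓝 z, dirDeriv (Y w) (cplx fun w => a w * Real.exp (b w)) w = 0)
    (h0 : a z = 0) (hnull : levi a (Y z) (Y z) z = 0) :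
    dirDeriv X (fun w => levi (fun w => a w * Real.exp (b w)) (Y w) (Y w) w) z =
      Real.exp (b z) * (dirDeriv X (fun w => levi a (Y w) (Y w) w) z +
        dirDeriv X (cplx a) z * (levi b (Y z) (Y z) z -
          Complex.normSq (dirDeriv (Y z) (cplx b) z))) := by
  have haz := ha.self_of_nhds
  have hbz := hb.self_of_nhds
  have hS := contDiffAt_dirDeriv (contDiffAt_cplx hbz) hY
  have hK := differentiableAt_of_top
    ((contDiffAt_levi hbz hY hY).sub (hS.mul (contDiffAt_conj hS)))
  have hH := differentiableAt_of_top (contDiffAt_levi haz hY hY)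
  have hE := differentiableAt_cplx (differentiableAt_of_top hbz).exp
  have hA := differentiableAt_cplx (differentiableAt_of_top haz)
  have hev : (fun w => levi (fun w => a w * Real.exp (b w)) (Y w) (Y w) w) =ᶠ[𝓝 z] fun w =>
      cplx (fun w => Real.exp (b w)) w * (levi a (Y w) (Y w) w + cplx a w *
        (levi b (Y w) (Y w) w -
          dirDeriv (Y w) (cplx b) w * (starRingEnd ℂ) (dirDeriv (Y w) (cplx b) w))) := by
    filter_upwards [htan, ha, hb] with w hw haw hbw
    rw [levi_mul_exp haw hbw, dirDeriv_eq_of_tangent_mul_exp (differentiableAt_of_top haw)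
      (differentiableAt_of_top hbw) hw]
    simp only [cplx, map_neg, map_mul, Complex.conj_ofReal]
    ring
  rw [dirDeriv_congr X hev, dirDeriv_mul X hE (hH.fun_add (hA.fun_mul hK)),
    dirDeriv_add X hH (hA.fun_mul hK), dirDeriv_mul X hA hK, Complex.mul_conj, hnull]
  simp only [cplx, h0, Complex.ofReal_zero]
  ring

end Jet

/-- Lemma 2.2, key lemma: for `ρ̃ = ρ e^ψ`, the normal components of the
Levi form and the normal derivative of `L_ρ(L,L)` transform as stated, at points of `Σ_L`. -/
theorem key_lemma {n : ℕ} (hn : 2 ≤ n) (Ω V U : Set (Fin n → ℂ)) (ρ ψ : (Fin n → ℂ) → ℝ)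
    (hΩ : IsOpen Ω) (hbd : Bornology.IsBounded Ω)
    (hdef : IsDefFn Ω V ρ) (hpsc : ∀ p ∈ frontier Ω, LeviPseudoconvexAt ρ p)
    (hU : IsOpen U) (hfr : frontier Ω ⊆ U) (hUV : U ⊆ V)
    (hψ : ContDiffOn ℝ (⊤ : ℕ∞) ψ U)
    (ρt : (Fin n → ℂ) → ℝ) (hρt : ∀ z, ρt z = ρ z * Real.exp (ψ z))
    (L Lt : (Fin n → ℂ) → (Fin n → ℂ))
    (hL : IsTangentField ρ L U) (hLt : IsTangentField ρt Lt U)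
    (hagree : ∀ q ∈ frontier Ω, Lt q = L q)
    (p : Fin n → ℂ) (hp : p ∈ frontier Ω) (hSig : levi ρ (L p) (L p) p = 0) :
    (levi ρt (Lt p) (nfield ρt p) p) / (gradNorm ρt p : ℂ) =
      levi ρ (L p) (nfield ρ p) p / (gradNorm ρ p : ℂ) +
        1 / 2 * dirDeriv (L p) (cplx ψ) p ∧
    fieldDeriv (nfield ρt) (fun w => levi ρt (Lt w) (Lt w) w) p / (gradNorm ρt p : ℂ) =
      fieldDeriv (nfield ρ) (fun w => levi ρ (L w) (L w) w) p / (gradNorm ρ p : ℂ) +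
        1 / 2 * levi ψ (L p) (L p) p -
        1 / 2 * (Complex.normSq (dirDeriv (L p) (cplx ψ) p) : ℂ) -
        2 * (((levi ρ (L p) (nfield ρ p) p / (gradNorm ρ p : ℂ) *
          dirDerivBar (L p) (cplx ψ) p).re : ℝ) : ℂ) ∧
    (Complex.normSq (levi ρt (Lt p) (nfield ρt p) p) : ℂ) / (gradNorm ρt p : ℂ) ^ 2 +
        1 / 2 * fieldDeriv (nfield ρt) (fun w => levi ρt (Lt w) (Lt w) w) p /
          (gradNorm ρt p : ℂ) =
      (Complex.normSq (levi ρ (L p) (nfield ρ p) p) : ℂ) / (gradNorm ρ p : ℂ) ^ 2 +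
        1 / 2 * fieldDeriv (nfield ρ) (fun w => levi ρ (L w) (L w) w) p /
          (gradNorm ρ p : ℂ) +
        1 / 4 * levi ψ (L p) (L p) p := by
  obtain rfl : ρt = fun w => ρ w * Real.exp (ψ w) := funext hρt
  have hpU : p ∈ U := hfr hp
  have eρ : ∀ᶠ w in 𝓝 p, ContDiffAt ℝ (⊤ : ℕ∞) ρ w :=
    Filter.eventually_of_mem (hU.mem_nhds hpU) fun w hw => hdef.contDiffAt (hUV hw)
  have eψ : ∀ᶠ w in 𝓝 p, ContDiffAt ℝ (⊤ : ℕ∞) ψ w :=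
    Filter.eventually_of_mem (hU.mem_nhds hpU) fun w hw => hψ.contDiffAt (hU.mem_nhds hw)
  have cρ := eρ.self_of_nhds
  have cψ := eψ.self_of_nhds
  have cL : ContDiffAt ℝ (⊤ : ℕ∞) L p := hL.1.contDiffAt (hU.mem_nhds hpU)
  have cLt : ContDiffAt ℝ (⊤ : ℕ∞) Lt p := hLt.1.contDiffAt (hU.mem_nhds hpU)
  have dρ := differentiableAt_of_top cρ
  have dψ := differentiableAt_of_top cψ
  have h0 := hdef.eq_zero_of_frontier hΩ hp
  have hLp : Lt p = L p := hagree p hp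
  have htan : dirDeriv (L p) (cplx ρ) p = 0 := hL.2 p hpU
  have htant : ∀ᶠ w in 𝓝 p, dirDeriv (Lt w) (cplx fun w => ρ w * Real.exp (ψ w)) w = 0 :=
    Filter.eventually_of_mem (hU.mem_nhds hpU) hLt.2
  set G : ℂ := (gradNorm ρ p : ℂ) with hG
  have he : (Real.exp (ψ p) : ℂ) ≠ 0 := Complex.ofReal_ne_zero.2 (Real.exp_pos _).ne'
  have hG0 : G ≠ 0 := Complex.ofReal_ne_zero.2 (gradNorm_ne_zero (hdef.grad_ne p hp))
  set N := nfield ρ p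
  set S := dirDeriv (L p) (cplx ψ) p
  have hNρ : dirDeriv N (cplx ρ) p = G / 2 := dirDeriv_nfield dρ
  -- the first-order jet of `Lt - L` at `p` is normal
  have hv : ∀ j, ∃ c : ℂ, ∀ x, fderiv ℝ (fun w => Lt w j - L w j) p x =
      c * (fderiv ℝ ρ p x : ℝ) := fun j => by
    refine exists_fderiv_eq_mul_complex cρ
      ((contDiffAt_pi.1 cLt j).sub (contDiffAt_pi.1 cL j)) (hdef.grad_ne p hp) ?_
    filter_upwards [hdef.eventually_mem_frontier hp] with q hq hq'
    simp [hagree q (hq (hq'.trans h0)), hLp]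
  choose v hv using hv
  have dL : ∀ j, DifferentiableAt ℝ (fun w => L w j) p := fun j =>
    differentiableAt_of_top (contDiffAt_pi.1 cL j)
  have dLt : ∀ j, DifferentiableAt ℝ (fun w => Lt w j) p := fun j =>
    differentiableAt_of_top (contDiffAt_pi.1 cLt j)
  have dD : ∀ j, DifferentiableAt ℝ (fun w => Lt w j - L w j) p := fun j =>
    (dLt j).fun_sub (dL j)
  have hD : ∀ j, dirDeriv N (fun w => Lt w j - L w j) p = v j * (G / 2) := fun j => by
    rw [dirDeriv_of_fderiv_eq_mul N dρ (hv j), hNρ]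
  have hvρ : dirDeriv v (cplx ρ) p = -S := by
    have cS := contDiffAt_dirDeriv (contDiffAt_cplx cψ) cLt
    have hev : (fun w => ∑ j, (Lt w j - L w j) * dz j (cplx ρ) w) =ᶠ[𝓝 p]
        fun w => cplx ρ w * -dirDeriv (Lt w) (cplx ψ) w := by
      filter_upwards [htant, eρ, eψ,
        hU.mem_nhds hpU] with w hw hρw hψw hwU
      have h1 := dirDeriv_eq_of_tangent_mul_exp (differentiableAt_of_top hρw)
        (differentiableAt_of_top hψw) hw
      have h2 := dirDeriv_sub_left (f := cplx ρ) (z := w) (Lt w) (L w)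
      rw [h1, hL.2 w hwU] at h2
      simp only [dirDeriv, Pi.sub_apply] at h2 ⊢
      rw [h2]
      simp only [cplx]
      ring
    have hdz : ∀ j, DifferentiableAt ℝ (dz j (cplx ρ)) p := fun j =>
      differentiableAt_of_top (contDiffAt_dz j (contDiffAt_cplx cρ))
    have h1 := dirDeriv_congr N hev
    rw [dirDeriv_sum _ _ fun j _ => (dD j).fun_mul (hdz j),
      dirDeriv_mul N (differentiableAt_cplx dρ) (differentiableAt_of_top cS).fun_neg, hNρ] at h1
    simp only [dirDeriv_mul N (dD _) (hdz _), hD, hLp, sub_self, zero_mul, zero_add, cplx, h0,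
      Complex.ofReal_zero] at h1
    have h2 : G / 2 * dirDeriv v (cplx ρ) p = G / 2 * -S := by
      rw [← h1, dirDeriv, Finset.mul_sum]
      exact Finset.sum_congr rfl fun _ _ => by ring
    exact mul_left_cancel₀ (div_ne_zero hG0 two_ne_zero) h2
  -- pseudoconvexity kills the tangential part of `v`
  have hLv : levi ρ (L p) v p =
      -2 * (starRingEnd ℂ) S / G * levi ρ (L p) N p := by
    set c : ℂ := -2 * S / G with hc
    have hT : dirDeriv (v - c • N) (cplx ρ) p = 0 := by
      rw [dirDeriv_sub_left, dirDeriv_smul_left, hvρ, hNρ, hc]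
      field_simp
      ring
    have h1 := levi_eq_zero_of_null cρ (hpsc p hp) htan hT hSig
    have h2 : v = (v - c • N) + c • N := by simp
    rw [h2, levi_add_right, h1, levi_smul_right, zero_add, hc]
    simp [hG, map_ofNat]
  have hjet : dirDeriv N (fun w => levi ρ (Lt w) (Lt w) w) p =
      dirDeriv N (fun w => levi ρ (L w) (L w) w) p +
        G / 2 * (levi ρ v (L p) p + levi ρ (L p) v p) := by
    refine dirDeriv_levi_change N v (G / 2) cρ cLt cL hLp (fun j => ?_) (fun j => ?_)
    · rw [← hD, ← dirDeriv_add N (dL j) (dD j)]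
      simp
    · rw [← hNρ, ← dirDeriv_of_fderiv_eq_mul N dρ (fderiv_conj_of_eq_mul (dD j) (hv j)),
        ← dirDeriv_add N
          (differentiableAt_of_top (contDiffAt_conj (contDiffAt_pi.1 cL j)))
          (differentiableAt_of_top (contDiffAt_conj
            ((contDiffAt_pi.1 cLt j).sub (contDiffAt_pi.1 cL j))))]
      simp
  set A : ℂ := levi ρ (L p) N p / G with hA
  have hre : levi ρ v (L p) p + levi ρ (L p) v p =
      -4 * (((A * (starRingEnd ℂ) S).re : ℝ) : ℂ) := by
    rw [← levi_conj cρ (L p) v, add_comm, Complex.add_conj, hLv,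
      show -2 * (starRingEnd ℂ) S / G * levi ρ (L p) N p = ((-2 : ℝ) : ℂ) *
        (A * (starRingEnd ℂ) S) by rw [hA]; push_cast; ring, Complex.re_ofReal_mul]
    push_cast
    ring
  have hi : levi (fun w => ρ w * Real.exp (ψ w)) (L p) N p / (Real.exp (ψ p) * G) =
      A + 1 / 2 * S := by
    rw [levi_mul_exp cρ cψ, htan, hNρ, h0, hA, hG]
    simp only [map_div₀, Complex.conj_ofReal, map_ofNat, Complex.ofReal_zero]
    rw [← hG]
    field_simp
    ring
  have hii : dirDeriv N (fun w => levi (fun w => ρ w * Real.exp (ψ w)) (Lt w) (Lt w) w) p /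
      (Real.exp (ψ p) * G) =
      dirDeriv N (fun w => levi ρ (L w) (L w) w) p / G + 1 / 2 * levi ψ (L p) (L p) p -
        1 / 2 * (Complex.normSq S : ℂ) - 2 * (((A * (starRingEnd ℂ) S).re : ℝ) : ℂ) := by
    rw [dirDeriv_levi_mul_exp N eρ eψ cLt htant h0 (by rw [hLp]; exact hSig), hLp, hjet, hNρ, hre]
    field_simp
    ring
  simp only [fieldDeriv, nfield_mul_exp dρ dψ h0, gradNorm_mul_exp dρ dψ h0, hLp,
    dirDerivBar_cplx (L p) dψ, Complex.ofReal_mul]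
  refine ⟨hi, hii, ?_⟩
  have hsq : ∀ (w : ℂ) (t : ℝ), (Complex.normSq w : ℂ) / (t : ℂ) ^ 2 =
      (Complex.normSq (w / t) : ℂ) := fun w t => by
    rw [Complex.normSq_div, Complex.normSq_ofReal]
    push_cast
    ring
  rw [mul_div_assoc, mul_div_assoc, hii, hG, ← Complex.ofReal_mul, hsq, hsq, Complex.ofReal_mul,
    ← hG, hi, ← hA]
  rw [Complex.normSq_add]
  have h1 : (A * (starRingEnd ℂ) (1 / 2 * S)).re = 1 / 2 * (A * (starRingEnd ℂ) S).re := by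
    rw [← Complex.re_ofReal_mul]
    congr 1
    simp [map_ofNat]
    ring
  rw [h1, Complex.normSq_mul]
  push_cast
  norm_num
  ring
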